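/- Osband's principle: let F be a convex class of Borel probability distributions on Ω ⊆ ℝ^d, and let T : F → A ⊆ ℝ^k be a surjective functional with a strict F-identification function V : A × Ω → ℝ^k and a strictly F-consistent scoring function S : A × Ω → ℝ. Assume (V1): for every x ∈ int(A) there exist F_1,…,F_{k+1} ∈ F such that 0 lies in the interior of the convex hull of {V̄(x,F_1),…,V̄(x,F_{k+1})}; and (S1): for every F ∈ F the map x ↦ S̄(x,F) is continuously differentiable on int(A). Then there exists a matrix-valued function h : int(A) → ℝ^{k×k} such that ∂_l S̄(x,F) = Σ_{m=1}^k h_{lm}(x) V̄_m(x,F) for all l ∈ {1,…,k}, all x ∈ int(A) and all F ∈ F. -/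

import Mathlib

open MeasureTheory Set

/-- A scoring function (with the required integrability) that is `𝓕`-consistent for `T`. -/
def IsConsistentScoring {E X : Type*} [MeasurableSpace E]
    (𝓕 : Set (Measure E)) (A : Set X) (T : Measure E → X) (S : X → E → ℝ) : Prop :=
  (∀ μ ∈ 𝓕, ∀ x ∈ A, Integrable (S x) μ) ∧
  ∀ μ ∈ 𝓕, ∀ x ∈ A, (∫ y, S (T μ) y ∂μ) ≤ ∫ y, S x y ∂μ

/-- A strictly `𝓕`-consistent scoring function for `T`. -/
def IsStrictlyConsistentScoring {E X : Type*} [MeasurableSpace E]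
    (𝓕 : Set (Measure E)) (A : Set X) (T : Measure E → X) (S : X → E → ℝ) : Prop :=
  IsConsistentScoring 𝓕 A T S ∧
  ∀ μ ∈ 𝓕, ∀ x ∈ A, (∫ y, S (T μ) y ∂μ) = (∫ y, S x y ∂μ) → x = T μ

/-- A strict `𝓕`-identification function for `T` (including the required integrability). -/
def IsStrictIdentification {E : Type*} [MeasurableSpace E] {k : ℕ}
    (𝓕 : Set (Measure E)) (A : Set (EuclideanSpace ℝ (Fin k)))
    (T : Measure E → EuclideanSpace ℝ (Fin k))
    (V : EuclideanSpace ℝ (Fin k) → E → EuclideanSpace ℝ (Fin k)) : Prop :=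
  (∀ μ ∈ 𝓕, ∀ x ∈ A, Integrable (V x) μ) ∧
  ∀ μ ∈ 𝓕, ∀ x ∈ A, ((∫ y, V x y ∂μ) = 0 ↔ x = T μ)

/-- A convex class of measures: stable under mixtures `(1-λ)F₀ + λF₁`, `λ ∈ (0,1)`. -/
def ConvexClass {E : Type*} [MeasurableSpace E] (𝓕 : Set (Measure E)) : Prop :=
  ∀ μ ∈ 𝓕, ∀ ν ∈ 𝓕, ∀ lam ∈ Set.Ioo (0 : ℝ) 1,
    ENNReal.ofReal (1 - lam) • μ + ENNReal.ofReal lam • ν ∈ 𝓕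

/-- A convex cone that projects onto the first factor and meets the vertical fibre over `0` only
at the origin is contained in the graph of a linear map. -/
lemma ConvexCone.exists_linearMap_of_forall_zero {W D : Type*} [AddCommGroup W] [Module ℝ W]
    [AddCommGroup D] [Module ℝ D] (K : ConvexCone ℝ (W × D))
    (hsurj : ∀ w, ∃ d, (w, d) ∈ K) (hzero : ∀ d, (0, d) ∈ K → d = 0) :
    ∃ L : W →ₗ[ℝ] D, ∀ p ∈ K, p.2 = L p.1 := by
  choose f hf using hsurj
  have hneg (w : W) (d : D) (hd : (w, d) ∈ K) : d = -f (-w) := by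
    have h := K.add_mem hd (hf (-w))
    rw [Prod.mk_add_mk, add_neg_cancel] at h
    exact eq_neg_of_add_eq_zero_left (hzero _ h)
  have huniq (w : W) (d : D) (hd : (w, d) ∈ K) : d = f w :=
    (hneg w d hd).trans (hneg w _ (hf w)).symm
  have hadd (v w : W) : f (v + w) = f v + f w := (huniq _ _ (K.add_mem (hf v) (hf w))).symm
  have hpos (c : ℝ) (hc : 0 < c) (w : W) : f (c • w) = c • f w :=
    (huniq _ _ (K.smul_mem hc (hf w))).symm
  have hf_neg (w : W) : f (-w) = -f w := by rw [hneg w _ (hf w), neg_neg]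
  have hf_zero : f 0 = 0 := hzero _ (hf 0)
  refine ⟨⟨⟨f, hadd⟩, fun c w => ?_⟩, fun p hp => huniq _ _ hp⟩
  rcases lt_trichotomy c 0 with hc | rfl | hc
  · have h := hpos (-c) (neg_pos.2 hc) w
    rw [neg_smul, neg_smul, hf_neg] at h
    exact neg_injective h
  · simp [hf_zero]
  · exact hpos c hc w

/-- A convex set whose first projection is a neighbourhood of `0` and which meets the vertical
fibre over `0` only at the origin is contained in the graph of a linear map. -/
lemma Convex.exists_linearMap_of_forall_zero {W D : Type*} [NormedAddCommGroup W]
    [NormedSpace ℝ W] [AddCommGroup D] [Module ℝ D] {C : Set (W × D)} (hC : Convex ℝ C)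
    (hint : (0 : W) ∈ interior (Prod.fst '' C)) (hzero : ∀ d, (0, d) ∈ C → d = 0) :
    ∃ L : W →ₗ[ℝ] D, ∀ p ∈ C, p.2 = L p.1 := by
  suffices h : ∃ L : W →ₗ[ℝ] D, ∀ p ∈ ConvexCone.hull ℝ C, p.2 = L p.1 from
    h.imp fun L hL p hp => hL p (ConvexCone.subset_hull hp)
  refine (ConvexCone.hull ℝ C).exists_linearMap_of_forall_zero (fun w => ?_) (fun d hd => ?_)
  · have hcont : Filter.Tendsto (fun t : ℝ => t • w) (nhdsWithin 0 (Ioi 0)) (nhds 0) :=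
      ((continuous_id.smul continuous_const).tendsto' (0 : ℝ) (0 : W) (zero_smul ℝ w)).mono_left
        nhdsWithin_le_nhds
    obtain ⟨t, ⟨p, hp, hpt⟩, ht⟩ :=
      ((hcont.eventually (mem_interior_iff_mem_nhds.1 hint)).and self_mem_nhdsWithin).exists
    refine ⟨t⁻¹ • p.2, (ConvexCone.mem_hull_of_convex hC).2
      ⟨t⁻¹, inv_pos.2 ht, p, hp, Prod.ext ?_ rfl⟩⟩
    simp only [Prod.smul_fst, hpt]
    exact inv_smul_smul₀ (ne_of_gt ht) w
  · obtain ⟨c, hc, ⟨w, d'⟩, hy, h⟩ := (ConvexCone.mem_hull_of_convex hC).1 hd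
    obtain ⟨h1, h2⟩ := Prod.ext_iff.1 h
    have hw : w = 0 := (smul_eq_zero.1 h1).resolve_left hc.ne'
    subst hw
    simpa [hzero d' hy] using h2.symm

/-- The integral against a mixture is the mixture of the integrals. -/
lemma integral_mixture {E F : Type*} [MeasurableSpace E] [NormedAddCommGroup F] [NormedSpace ℝ F]
    {μ ν : Measure E} {f : E → F} (hμ : Integrable f μ) (hν : Integrable f ν) {a b : ℝ}
    (ha : 0 ≤ a) (hb : 0 ≤ b) :
    ∫ y, f y ∂(ENNReal.ofReal a • μ + ENNReal.ofReal b • ν) =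
      a • ∫ y, f y ∂μ + b • ∫ y, f y ∂ν := by
  rw [integral_add_measure (hμ.smul_measure ENNReal.ofReal_ne_top)
    (hν.smul_measure ENNReal.ofReal_ne_top), integral_smul_measure, integral_smul_measure,
    ENNReal.toReal_ofReal ha, ENNReal.toReal_ofReal hb]

/-- A convex class is stable under weights `a + b = 1`, including the degenerate ones. -/
lemma ConvexClass.mixture_mem {E : Type*} [MeasurableSpace E] {𝓕 : Set (Measure E)}
    (h𝓕 : ConvexClass 𝓕) {μ ν : Measure E} (hμ : μ ∈ 𝓕) (hν : ν ∈ 𝓕) {a b : ℝ}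
    (ha : 0 ≤ a) (hb : 0 ≤ b) (hab : a + b = 1) :
    ENNReal.ofReal a • μ + ENNReal.ofReal b • ν ∈ 𝓕 := by
  obtain rfl : a = 1 - b := by linarith
  rcases hb.eq_or_lt with rfl | hb
  · simpa using hμ
  rcases ha.eq_or_lt with ha | ha
  · obtain rfl : b = 1 := by linarith
    simpa using hν
  exact h𝓕 μ hμ ν hν b ⟨hb, by linarith⟩

/-- **Osband's principle.** Under assumptions (V1) and (S1), there is a
matrix-valued function `h : int(A) → ℝ^{k×k}` with
`∂ₗ S̄(x,F) = ∑ₘ h_{lm}(x) V̄ₘ(x,F)` for all `l`, all `x ∈ int(A)` and all `F ∈ 𝓕`. -/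
theorem statement10 {E : Type*} [MeasurableSpace E] {k : ℕ}
    (𝓕 : Set (Measure E)) (hprob : ∀ μ ∈ 𝓕, IsProbabilityMeasure μ)
    (hconv : ConvexClass 𝓕)
    (A : Set (EuclideanSpace ℝ (Fin k)))
    (T : Measure E → EuclideanSpace ℝ (Fin k)) (hT : ∀ μ ∈ 𝓕, T μ ∈ A)
    (hsurj : ∀ x ∈ A, ∃ μ ∈ 𝓕, T μ = x)
    (V : EuclideanSpace ℝ (Fin k) → E → EuclideanSpace ℝ (Fin k))
    (hV : IsStrictIdentification 𝓕 A T V)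
    (S : EuclideanSpace ℝ (Fin k) → E → ℝ)
    (hS : IsStrictlyConsistentScoring 𝓕 A T S)
    -- Assumption (V1):
    (hV1 : ∀ x ∈ interior A, ∃ G : Fin (k + 1) → Measure E, (∀ i, G i ∈ 𝓕) ∧
      (0 : EuclideanSpace ℝ (Fin k)) ∈
        interior (convexHull ℝ (Set.range fun i => ∫ y, V x y ∂(G i))))
    -- Assumption (S1):
    (hS1 : ∀ μ ∈ 𝓕, ContDiffOn ℝ 1 (fun x => ∫ y, S x y ∂μ) (interior A)) :
    ∃ h : EuclideanSpace ℝ (Fin k) → Fin k → Fin k → ℝ,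
      ∀ x ∈ interior A, ∀ μ ∈ 𝓕, ∀ l : Fin k,
        fderiv ℝ (fun z => ∫ y, S z y ∂μ) x (EuclideanSpace.single l 1) =
          ∑ m : Fin k, h x l m * (∫ y, V x y ∂μ) m := by
  have hdiff {x} (hx : x ∈ interior A) {μ} (hμ : μ ∈ 𝓕) :
      DifferentiableAt ℝ (fun z => ∫ y, S z y ∂μ) x :=
    ((hS1 μ hμ).differentiableOn one_ne_zero).differentiableAt (isOpen_interior.mem_nhds hx)
  have key (x) (hx : x ∈ interior A) :
      ∃ L : EuclideanSpace ℝ (Fin k) →ₗ[ℝ] (EuclideanSpace ℝ (Fin k) →L[ℝ] ℝ), ∀ μ ∈ 𝓕,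
        fderiv ℝ (fun z => ∫ y, S z y ∂μ) x = L (∫ y, V x y ∂μ) := by
    have hxA : x ∈ A := interior_subset hx
    let φ : Measure E → EuclideanSpace ℝ (Fin k) × (EuclideanSpace ℝ (Fin k) →L[ℝ] ℝ) :=
      fun μ => (∫ y, V x y ∂μ, fderiv ℝ (fun z => ∫ y, S z y ∂μ) x)
    have hC : Convex ℝ (φ '' 𝓕) := by
      rintro _ ⟨μ, hμ, rfl⟩ _ ⟨ν, hν, rfl⟩ a b ha hb hab
      refine ⟨_, hconv.mixture_mem hμ hν ha hb hab, Prod.ext ?_ ?_⟩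
      · exact integral_mixture (hV.1 μ hμ x hxA) (hV.1 ν hν x hxA) ha hb
      · have hev : (fun z => ∫ y, S z y ∂(ENNReal.ofReal a • μ + ENNReal.ofReal b • ν))
            =ᶠ[nhds x] fun z => a • (∫ y, S z y ∂μ) + b • ∫ y, S z y ∂ν := by
          filter_upwards [mem_interior_iff_mem_nhds.1 hx] with z hz
          exact integral_mixture (hS.1.1 μ hμ z hz) (hS.1.1 ν hν z hz) ha hb
        exact hev.fderiv_eq.trans (((hdiff hx hμ).hasFDerivAt.const_smul a).add
          ((hdiff hx hν).hasFDerivAt.const_smul b)).fderiv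
    suffices h : ∃ L : EuclideanSpace ℝ (Fin k) →ₗ[ℝ] (EuclideanSpace ℝ (Fin k) →L[ℝ] ℝ),
        ∀ p ∈ φ '' 𝓕, p.2 = L p.1 from
      h.imp fun L hL μ hμ => hL _ (mem_image_of_mem φ hμ)
    refine hC.exists_linearMap_of_forall_zero ?_ ?_
    · obtain ⟨G, hG, h0⟩ := hV1 x hx
      refine interior_mono (convexHull_min ?_ (hC.linear_image (LinearMap.fst ℝ _ _))) h0
      rintro _ ⟨i, rfl⟩
      exact ⟨φ (G i), mem_image_of_mem φ (hG i), rfl⟩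
    · rintro d ⟨μ, hμ, h⟩
      obtain ⟨h1, rfl⟩ := Prod.ext_iff.1 h
      obtain rfl := (hV.2 μ hμ x hxA).1 h1
      refine IsLocalMin.fderiv_eq_zero ?_
      filter_upwards [mem_interior_iff_mem_nhds.1 hx] with z hz
      exact hS.1.2 μ hμ z hz
  choose! L hL using key
  refine ⟨fun x l m => L x (EuclideanSpace.single m 1) (EuclideanSpace.single l 1),
    fun x hx μ hμ l => ?_⟩
  rw [hL x hx μ hμ]
  set v := ∫ y, V x y ∂μ
  conv_lhs => rw [← (EuclideanSpace.basisFun (Fin k) ℝ).sum_repr v]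
  simp [mul_comm]
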